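/- (Core of Proposition 4.4) Let M be an open Riemann surface and let F = (F₁,F₂) : M → ℂ² be a holomorphic map. If the map Ψ : S¹ × M → ℝ² given by Ψ(𝔳,P) = (Re(𝔳·F₁(P)), Re(𝔳·F₂(P))) is proper, then both coordinate functions F₁ : M → ℂ and F₂ : M → ℂ are proper maps. -/

import Mathlib

open scoped Manifold

lemma exists_rot (w : ℂ) : ∃ v : Metric.sphere (0 : ℂ) 1, ((v : ℂ) * w).re = 0 := by
  by_cases hw : w = 0
  · exact ⟨⟨1, by simp⟩, by simp [hw]⟩
  · have hn : ‖w‖ ≠ 0 := norm_ne_zero_iff.mpr hw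
    refine ⟨⟨Complex.I * ((starRingEnd ℂ) w * ((‖w‖⁻¹ : ℝ) : ℂ)), ?_⟩, ?_⟩
    · rw [mem_sphere_zero_iff_norm, norm_mul, norm_mul, Complex.norm_I, Complex.norm_conj,
        Complex.norm_real, norm_inv, norm_norm, one_mul, mul_inv_cancel₀ hn]
    · simp only [Complex.mul_re, Complex.mul_im, Complex.I_re, Complex.I_im, Complex.conj_re,
        Complex.conj_im, Complex.ofReal_re, Complex.ofReal_im]
      ring

lemma rot_bound (v : Metric.sphere (0 : ℂ) 1) (z : ℂ) (R : ℝ) (hz : ‖z‖ ≤ R) :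
    ((v : ℂ) * z).re ∈ Set.Icc (-R) R := by
  have h := Complex.abs_re_le_norm ((v : ℂ) * z)
  rw [norm_mul, mem_sphere_zero_iff_norm.mp v.2, one_mul] at h
  exact abs_le.mp (h.trans hz)

/-- Core of Proposition 4.4: if `Ψ : S¹ × M → ℝ²`, `Ψ(𝔳,P) = Re (𝔳 (F₁, F₂)(P))`, is
proper for a holomorphic map `F = (F₁, F₂) : M → ℂ²` on an open Riemann surface `M`,
then both `F₁` and `F₂` are proper. -/
theorem proposition_4_4_core
    (M : Type) [TopologicalSpace M] [ChartedSpace ℂ M]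
    [IsManifold 𝓘(ℂ, ℂ) (⊤ : ℕ∞) M] [T2Space M] [ConnectedSpace M]
    (hM : ¬ CompactSpace M)
    (F : M → ℂ × ℂ) (hF : MDifferentiable 𝓘(ℂ, ℂ) 𝓘(ℂ, ℂ × ℂ) F)
    (hΨ : ∀ K : Set (ℝ × ℝ), IsCompact K →
      IsCompact {q : Metric.sphere (0 : ℂ) 1 × M |
        (((q.1 : ℂ) * (F q.2).1).re, ((q.1 : ℂ) * (F q.2).2).re) ∈ K}) :
    (∀ K : Set ℂ, IsCompact K → IsCompact ((fun P => (F P).1) ⁻¹' K)) ∧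
    (∀ K : Set ℂ, IsCompact K → IsCompact ((fun P => (F P).2) ⁻¹' K)) := by
  have hc : Continuous F := hF.continuous
  constructor
  · intro K hK
    obtain ⟨R, hR⟩ := hK.isBounded.exists_norm_le
    refine ((hΨ (Set.Icc (-R) R ×ˢ {0}) (isCompact_Icc.prod isCompact_singleton)).image
      continuous_snd).of_isClosed_subset (hK.isClosed.preimage hc.fst) ?_
    intro P hP
    obtain ⟨v, hv⟩ := exists_rot (F P).2
    exact ⟨(v, P), ⟨rot_bound v _ R (hR _ hP), hv⟩, rfl⟩
  · intro K hK
    obtain ⟨R, hR⟩ := hK.isBounded.exists_norm_le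
    refine ((hΨ ({0} ×ˢ Set.Icc (-R) R) (isCompact_singleton.prod isCompact_Icc)).image
      continuous_snd).of_isClosed_subset (hK.isClosed.preimage hc.snd) ?_
    intro P hP
    obtain ⟨v, hv⟩ := exists_rot (F P).1
    exact ⟨(v, P), ⟨hv, rot_bound v _ R (hR _ hP)⟩, rfl⟩
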